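/- For every real β > 0, every real h ≥ 0, every integer N ≥ 1 and every φ : Λ_N → ℤ≥0, one has Σ_{A ⊆ φ^{−1}(0)} P_N^{β,h}(U_A φ) ≥ exp( −4βN − h|φ^{−1}(0)| ) · (1 + e^{−(4β−h)})^{|φ^{−1}(0)|} · P_N^{β,h}(φ), where for A ⊆ φ^{−1}(0), U_A φ : Λ_N → ℤ≥0 is defined by (U_A φ)(x) = φ(x) + 1 if x ∉ A and (U_A φ)(x) = 0 if x ∈ A. -/

import Mathlib

open Real Finset
open scoped Classical

noncomputable section

/-- The box `Λ_N = {1,…,N}²` in `ℤ²`. -/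
def Lam (N : ℕ) : Finset (ℤ × ℤ) := Finset.Icc (1:ℤ) (N:ℤ) ×ˢ Finset.Icc (1:ℤ) (N:ℤ)

/-- The four nearest neighbors of a site of `ℤ²`. -/
def nbrs (x : ℤ × ℤ) : Finset (ℤ × ℤ) :=
  {(x.1 + 1, x.2), (x.1 - 1, x.2), (x.1, x.2 + 1), (x.1, x.2 - 1)}

/-- An enlarged box containing all edges touching `Λ_N`. -/
def Box (N : ℕ) : Finset (ℤ × ℤ) := Finset.Icc (0:ℤ) ((N:ℤ)+1) ×ˢ Finset.Icc (0:ℤ) ((N:ℤ)+1)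

/-- The SOS Hamiltonian with zero boundary conditions, for fields vanishing outside `Λ_N`:
each edge `{x,y}` with `x ~ y` touching `Λ_N` is counted twice in the double sum (once from
each endpoint, both endpoints lying in `Box N`), whence the factor `1/2`.  Since the field
vanishes outside `Λ_N`, this equals
`Σ_{{x,y}⊂Λ_N, x~y} |φ(x)−φ(y)| + Σ_{x∈Λ_N, y∉Λ_N, x~y} |φ(x)|`. -/
def Ham (N : ℕ) (φ : ℤ × ℤ → ℤ) : ℝ :=
  (1/2) * ∑ x ∈ Box N, ∑ y ∈ nbrs x, |(φ x : ℝ) - (φ y : ℝ)|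

/-- The level set `φ⁻¹(k)` inside `Λ_N`. -/
def levelSet (N : ℕ) (φ : ℤ × ℤ → ℤ) (k : ℤ) : Finset (ℤ × ℤ) :=
  (Lam N).filter fun x => φ x = k

/-- The configuration space `Ω_N`: nonnegative integer fields vanishing outside `Λ_N`. -/
def Conf (N : ℕ) : Type :=
  {φ : ℤ × ℤ → ℤ // (∀ x, 0 ≤ φ x) ∧ ∀ x ∉ Lam N, φ x = 0}

/-- The Boltzmann weight `exp(−β H_N(φ) + h |φ⁻¹(0)|)`. -/
def weight (N : ℕ) (β h : ℝ) (φ : ℤ × ℤ → ℤ) : ℝ :=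
  Real.exp (-β * Ham N φ + h * ((levelSet N φ 0).card : ℝ))

/-- The partition function `Z_N^{β,h}`. -/
def Z (N : ℕ) (β h : ℝ) : ℝ := ∑' φ : Conf N, weight N β h φ.val

/-- The probability of an event `E ⊆ Ω_N` under `P_N^{β,h}`. -/
def prob (N : ℕ) (β h : ℝ) (E : Set (Conf N)) : ℝ :=
  (∑' φ : Conf N, if φ ∈ E then weight N β h φ.val else 0) / Z N β h

/-- The critical pinning value `h_w(β) = log(e^{4β}/(e^{4β}−1))`. -/
def hw (β : ℝ) : ℝ := Real.log (Real.exp (4*β) / (Real.exp (4*β) - 1))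

/-- The lifting map `U_A`: raise the surface by one everywhere on `Λ_N` except on `A`,
which is kept at height `0` (and extend by `0` outside `Λ_N`). -/
def UA (N : ℕ) (A : Finset (ℤ × ℤ)) (φ : ℤ × ℤ → ℤ) : ℤ × ℤ → ℤ :=
  fun x => if x ∈ Lam N then (if x ∈ A then 0 else φ x + 1) else 0

lemma sum_nbrs (f : ℤ × ℤ → ℝ) (x : ℤ × ℤ) :
    ∑ y ∈ nbrs x, f y =
      f (x.1 + 1, x.2) + f (x.1 - 1, x.2) + f (x.1, x.2 + 1) + f (x.1, x.2 - 1) := by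
  unfold nbrs
  rw [sum_insert, sum_insert, sum_insert, sum_singleton]
  · ring
  all_goals simp only [mem_insert, mem_singleton, Prod.mk.injEq]; omega

/-- The indicator function of a finite set of sites. -/
def siteInd (S : Finset (ℤ × ℤ)) (x : ℤ × ℤ) : ℝ := if x ∈ S then 1 else 0

lemma siteInd_nonneg (S : Finset (ℤ × ℤ)) (x : ℤ × ℤ) : 0 ≤ siteInd S x := by
  unfold siteInd; split_ifs <;> norm_num

lemma sum_siteInd_comp_le (B S : Finset (ℤ × ℤ)) {g : ℤ × ℤ → ℤ × ℤ}
    (hg : Function.Injective g) : ∑ x ∈ B, siteInd S (g x) ≤ (S.card : ℝ) := by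
  unfold siteInd
  rw [sum_boole]
  exact_mod_cast card_le_card_of_injOn g (fun x hx => (mem_filter.mp hx).2) hg.injOn

lemma sum_le_card_of_le_siteInd (B S : Finset (ℤ × ℤ)) {f : ℤ × ℤ → ℝ}
    (hf : ∀ x, f x ≤ siteInd S x) : ∑ x ∈ B, f x ≤ (S.card : ℝ) :=
  (sum_le_sum fun x _ => hf x).trans (sum_siteInd_comp_le B S Function.injective_id)

/-- The number of oriented edges leaving or entering a set of sites `A`
is at most `8 |A|`. -/
lemma sum_abs_siteInd_sub_le (B A : Finset (ℤ × ℤ)) :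
    ∑ x ∈ B, ∑ y ∈ nbrs x, |siteInd A x - siteInd A y| ≤ 8 * (A.card : ℝ) := by
  have hle : ∀ x y, |siteInd A x - siteInd A y| ≤ siteInd A x + siteInd A y := fun x y => by
    rw [abs_le]
    constructor <;> linarith [siteInd_nonneg A x, siteInd_nonneg A y]
  refine (sum_le_sum fun x _ => sum_le_sum fun y _ => hle x y).trans ?_
  simp only [sum_nbrs, sum_add_distrib]
  have h0 := sum_siteInd_comp_le B A Function.injective_id
  simp only [id] at h0
  have h1 := sum_siteInd_comp_le B A (g := fun x => (x.1 + 1, x.2))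
    (fun x y h => by simpa [Prod.ext_iff] using h)
  have h2 := sum_siteInd_comp_le B A (g := fun x => (x.1 - 1, x.2))
    (fun x y h => by simpa [Prod.ext_iff] using h)
  have h3 := sum_siteInd_comp_le B A (g := fun x => (x.1, x.2 + 1))
    (fun x y h => by simpa [Prod.ext_iff] using h)
  have h4 := sum_siteInd_comp_le B A (g := fun x => (x.1, x.2 - 1))
    (fun x y h => by simpa [Prod.ext_iff] using h)
  linarith

lemma abs_siteInd_sub_le {S T : Finset (ℤ × ℤ)} {x y : ℤ × ℤ}
    (h : ¬(x ∈ S ↔ y ∈ S) → x ∈ T) : |siteInd S x - siteInd S y| ≤ siteInd T x := by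
  by_cases hS : x ∈ S ↔ y ∈ S
  · simp only [siteInd, hS, sub_self, abs_zero]
    split_ifs <;> norm_num
  · simp only [siteInd, h hS, if_true]
    split_ifs <;> norm_num

/-- The edge boundary of the box `Λ_N` has `4N` edges, each counted twice. -/
lemma sum_abs_siteInd_Lam_sub_le (N : ℕ) (B : Finset (ℤ × ℤ)) :
    ∑ x ∈ B, ∑ y ∈ nbrs x, |siteInd (Lam N) x - siteInd (Lam N) y| ≤ 8 * (N : ℝ) := by
  simp only [sum_nbrs, sum_add_distrib]
  have hpair : ∀ a b : ℤ, ((({a, b} : Finset ℤ).card : ℕ) : ℝ) ≤ 2 := fun a b => by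
    exact_mod_cast card_le_two
  have key₁ : ∀ (a b : ℤ) {g : ℤ × ℤ → ℤ × ℤ},
      (∀ x, ¬(x ∈ Lam N ↔ g x ∈ Lam N) → x ∈ ({a, b} : Finset ℤ) ×ˢ Icc (1 : ℤ) N) →
      ∑ x ∈ B, |siteInd (Lam N) x - siteInd (Lam N) (g x)| ≤ 2 * (N : ℝ) := by
    intro a b g hg
    refine (sum_le_card_of_le_siteInd B _ fun x => abs_siteInd_sub_le (hg x)).trans ?_
    simp only [card_product, Int.card_Icc, add_sub_cancel_right, Int.toNat_natCast, Nat.cast_mul]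
    gcongr
    exact hpair a b
  have key₂ : ∀ (a b : ℤ) {g : ℤ × ℤ → ℤ × ℤ},
      (∀ x, ¬(x ∈ Lam N ↔ g x ∈ Lam N) → x ∈ Icc (1 : ℤ) N ×ˢ ({a, b} : Finset ℤ)) →
      ∑ x ∈ B, |siteInd (Lam N) x - siteInd (Lam N) (g x)| ≤ 2 * (N : ℝ) := by
    intro a b g hg
    refine (sum_le_card_of_le_siteInd B _ fun x => abs_siteInd_sub_le (hg x)).trans ?_
    simp only [card_product, Int.card_Icc, add_sub_cancel_right, Int.toNat_natCast, Nat.cast_mul]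
    rw [mul_comm]
    gcongr
    exact hpair a b
  have h1 := key₁ 0 N (g := fun x => (x.1 + 1, x.2)) (fun x => by
    simp only [Lam, mem_product, mem_Icc, mem_insert, mem_singleton]; omega)
  have h2 := key₁ 1 (N + 1) (g := fun x => (x.1 - 1, x.2)) (fun x => by
    simp only [Lam, mem_product, mem_Icc, mem_insert, mem_singleton]; omega)
  have h3 := key₂ 0 N (g := fun x => (x.1, x.2 + 1)) (fun x => by
    simp only [Lam, mem_product, mem_Icc, mem_insert, mem_singleton]; omega)
  have h4 := key₂ 1 (N + 1) (g := fun x => (x.1, x.2 - 1)) (fun x => by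
    simp only [Lam, mem_product, mem_Icc, mem_insert, mem_singleton]; omega)
  linarith

lemma UA_cast_eq {N : ℕ} (φ : Conf N) {A : Finset (ℤ × ℤ)} (hA : A ⊆ levelSet N φ.val 0)
    (x : ℤ × ℤ) : (UA N A φ.val x : ℝ) = φ.val x + siteInd (Lam N) x - siteInd A x := by
  unfold UA siteInd
  by_cases hxA : x ∈ A
  · have hx := mem_filter.mp (hA hxA)
    simp [hxA, hx.1, hx.2]
  · by_cases hx : x ∈ Lam N
    · simp [hx, hxA]
    · simp [hx, hxA, φ.property.2 x hx]

lemma Ham_UA_le {N : ℕ} (φ : Conf N) {A : Finset (ℤ × ℤ)} (hA : A ⊆ levelSet N φ.val 0) :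
    Ham N (UA N A φ.val) ≤ Ham N φ.val + 4 * (N : ℝ) + 4 * (A.card : ℝ) := by
  have hle : ∀ x y, |(UA N A φ.val x : ℝ) - (UA N A φ.val y : ℝ)| ≤
      |(φ.val x : ℝ) - (φ.val y : ℝ)| + |siteInd (Lam N) x - siteInd (Lam N) y| +
        |siteInd A x - siteInd A y| := fun x y => by
    rw [UA_cast_eq φ hA, UA_cast_eq φ hA]
    refine le_trans (le_of_eq (congrArg _ ?_)) ((abs_sub _ _).trans
      (add_le_add_left (abs_add_le _ _) _))
    ring
  have hsum := sum_le_sum fun x (_ : x ∈ Box N) => sum_le_sum fun y (_ : y ∈ nbrs x) => hle x y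
  simp only [sum_add_distrib] at hsum
  have h1 := sum_abs_siteInd_Lam_sub_le N (Box N)
  have h2 := sum_abs_siteInd_sub_le (Box N) A
  unfold Ham
  linarith

lemma levelSet_UA_zero {N : ℕ} (φ : Conf N) {A : Finset (ℤ × ℤ)}
    (hA : A ⊆ levelSet N φ.val 0) : levelSet N (UA N A φ.val) 0 = A := by
  ext x
  have h0 := φ.property.1 x
  have hsub : x ∈ A → x ∈ Lam N := fun h => (mem_filter.mp (hA h)).1
  simp only [levelSet, UA]
  by_cases hx : x ∈ Lam N <;> by_cases hxA : x ∈ A <;> simp_all; omega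

lemma le_weight_UA {N : ℕ} {β : ℝ} (hβ : 0 ≤ β) (h : ℝ) (φ : Conf N) {A : Finset (ℤ × ℤ)}
    (hA : A ⊆ levelSet N φ.val 0) :
    exp (-β * Ham N φ.val - 4 * β * N) * exp (-(4 * β - h)) ^ A.card ≤
      weight N β h (UA N A φ.val) := by
  rw [weight, levelSet_UA_zero φ hA, ← exp_nat_mul, ← exp_add]
  refine exp_le_exp.mpr ?_
  have := mul_le_mul_of_nonneg_left (Ham_UA_le φ hA) hβ
  linarith

/-- Equation (3.2): summing the pointwise probabilities of the lifted configurations `U_A φ`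
over all `A ⊆ φ⁻¹(0)` yields at least
`e^{−4βN − h|φ⁻¹(0)|}(1 + e^{−(4β−h)})^{|φ⁻¹(0)|} P_N^{β,h}(φ)`. -/
theorem sum_UA_prob_lower_bound (β h : ℝ) (N : ℕ)
    (hβ : 0 < β) (hh : 0 ≤ h) (hN : 1 ≤ N) (φ : Conf N) :
    Real.exp (-4*β*(N:ℝ) - h * ((levelSet N φ.val 0).card : ℝ)) *
        (1 + Real.exp (-(4*β - h)))^((levelSet N φ.val 0).card) *
        (weight N β h φ.val / Z N β h) ≤
      ∑ A ∈ (levelSet N φ.val 0).powerset, weight N β h (UA N A φ.val) / Z N β h := by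
  have hZ : 0 ≤ Z N β h := tsum_nonneg fun _ => (exp_pos _).le
  rw [← sum_div, mul_div_assoc']
  refine div_le_div_of_nonneg_right ?_ hZ
  refine le_trans (le_of_eq ?_)
    (sum_le_sum fun A hA => le_weight_UA hβ.le h φ (mem_powerset.mp hA))
  have hpow := sum_pow_mul_eq_add_pow (exp (-(4 * β - h))) 1 (levelSet N φ.val 0)
  simp only [one_pow, mul_one] at hpow
  rw [← mul_sum, hpow, add_comm (exp (-(4 * β - h))), mul_right_comm, weight, ← exp_add]
  congr 2
  ring
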